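/- Consider the Bayesian learning dynamics and fix θ̄ ∈ Δ(S) with θ̄(s*) > 0. For every γ ∈ (0,1) and every κ ∈ (0,1), there exists ρ > 0 such that whenever the initial belief satisfies θ^1(s) < ρ for all s ∉ [θ̄] and θ^1(s*) > θ̄(s*) − ρ, one has P( θ^t(s) ≤ κ for all s ∉ [θ̄] and all t ≥ 1 ) > γ. -/

import Mathlib

open MeasureTheory ProbabilityTheory Filter Topology

noncomputable section

/-- Static environment of the Bayesian learning model: a convex compact strategy-profile
set `Q` and, for each parameter `s`, payoff densities `φ s q` on `ℝ^ι` (with respect to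
Lebesgue measure), jointly measurable and continuous in `q`. -/
def IsBayesEnv {ι S E : Type} [Fintype ι] [Fintype S]
    [NormedAddCommGroup E] [NormedSpace ℝ E] [MeasurableSpace E]
    (strue : S) (Q : Set E) (φ : S → E → (ι → ℝ) → ℝ) : Prop :=
  IsCompact Q ∧ Convex ℝ Q ∧
    (∀ s : S, Measurable fun p : E × (ι → ℝ) => φ s p.1 p.2) ∧
    (∀ (s : S) (x : ι → ℝ), ContinuousOn (fun q => φ s q x) Q) ∧
    (∀ s : S, ∀ q ∈ Q, (∀ x, 0 ≤ φ s q x) ∧ ∫ x : ι → ℝ, φ s q x = 1)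

/-- A run `(θ, q, c)` of the Bayesian learning dynamics on a filtered probability space:
the initial belief `θ0` has full support; `q t` is `F t`-measurable with values in `Q`;
conditionally on `F t` the payoff `c t` has density `φ strue (·∣q t)`; and beliefs are
updated by Bayes' rule. -/
def IsBayesProcess {ι S E Ω : Type} [Fintype ι] [Fintype S]
    [NormedAddCommGroup E] [NormedSpace ℝ E] [MeasurableSpace E]
    [mΩ : MeasurableSpace Ω]
    (P : Measure Ω) (F : Filtration ℕ mΩ)
    (strue : S) (Q : Set E) (φ : S → E → (ι → ℝ) → ℝ) (θ0 : S → ℝ)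
    (θ : ℕ → Ω → S → ℝ) (q : ℕ → Ω → E) (c : ℕ → Ω → ι → ℝ) : Prop :=
  (∀ s, 0 < θ0 s) ∧ (∑ s, θ0 s = 1) ∧ (∀ ω, θ 0 ω = θ0) ∧
    (∀ t ω, q t ω ∈ Q) ∧
    (∀ t, Measurable[F t] (q t)) ∧
    (∀ t, Measurable[F (t + 1)] (c t)) ∧
    (∀ t, Measurable[F t] (θ t)) ∧
    (∀ (t : ℕ) (g : E × (ι → ℝ) → ℝ), Measurable g → (∀ p, |g p| ≤ 1) →
      P[(fun ω => g (q t ω, c t ω))|F t]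
        =ᵐ[P] fun ω => ∫ x : ι → ℝ, g (q t ω, x) * φ strue (q t ω) x) ∧
    (∀ t ω s, θ (t + 1) ω s =
      θ t ω s * φ s (q t ω) (c t ω) / ∑ s', θ t ω s' * φ s' (q t ω) (c t ω))


/-- If `c` has conditional density `f (q ·)`, the likelihood ratio of any other family of densities
`f'` to `f` has conditional mean at most one. -/
lemma setLIntegral_likelihoodRatio_le {ι E Ω : Type} [Fintype ι] [MeasurableSpace E]
    {mΩ : MeasurableSpace Ω} {P : Measure Ω} [IsProbabilityMeasure P]
    {m : MeasurableSpace Ω} (hm : m ≤ mΩ) {f f' : E → (ι → ℝ) → ℝ}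
    (hf : Measurable fun p : E × (ι → ℝ) => f p.1 p.2)
    (hf' : Measurable fun p : E × (ι → ℝ) => f' p.1 p.2)
    {q : Ω → E} {c : Ω → ι → ℝ} (hq : Measurable[mΩ] q) (hc : Measurable[mΩ] c)
    (hf_dens : ∀ ω, (∀ x, 0 ≤ f (q ω) x) ∧ ∫ x, f (q ω) x = 1)
    (hf'_dens : ∀ ω, (∀ x, 0 ≤ f' (q ω) x) ∧ ∫ x, f' (q ω) x = 1)
    (hcond : ∀ g : E × (ι → ℝ) → ℝ, Measurable g → (∀ p, |g p| ≤ 1) →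
      P[(fun ω => g (q ω, c ω))|m] =ᵐ[P] fun ω => ∫ x : ι → ℝ, g (q ω, x) * f (q ω) x)
    {A : Set Ω} (hA : MeasurableSet[m] A) :
    ∫⁻ ω in A, ENNReal.ofReal (f' (q ω) (c ω) / f (q ω) (c ω)) ∂P ≤ P A := by
  have hqc : Measurable[mΩ] fun ω => (q ω, c ω) := hq.prodMk hc
  have hL : Measurable fun p : E × (ι → ℝ) => f' p.1 p.2 / f p.1 p.2 := hf'.div hf
  have htrunc : ∀ n : ℕ,
      ∫⁻ ω in A, ENNReal.ofReal (min (f' (q ω) (c ω) / f (q ω) (c ω)) (n + 1)) ∂P ≤ P A := by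
    intro n
    have hn : (0 : ℝ) < n + 1 := by positivity
    set g : E × (ι → ℝ) → ℝ :=
      fun p => max 0 (min (f' p.1 p.2 / f p.1 p.2) (n + 1)) / (n + 1) with hg
    have hgm : Measurable g :=
      (measurable_const.max (hL.min measurable_const)).div_const _
    have hg0 : ∀ p, 0 ≤ g p := fun p => by positivity
    have hg1 : ∀ p, g p ≤ 1 := fun p => by
      rw [hg]
      simp only
      rw [div_le_one hn]
      exact max_le hn.le (min_le_right _ _)
    have hgabs : ∀ p, |g p| ≤ 1 := fun p => by rw [abs_of_nonneg (hg0 p)]; exact hg1 p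
    have hint : Integrable (fun ω => g (q ω, c ω)) P :=
      Integrable.of_bound (hgm.comp hqc).aestronglyMeasurable 1 (ae_of_all _ fun ω => hgabs _)
    have hinner : ∀ ω, ∫ x : ι → ℝ, g (q ω, x) * f (q ω) x ≤ 1 / (n + 1) := by
      intro ω
      have hf'int : Integrable (f' (q ω)) :=
        Integrable.of_integral_ne_zero (by rw [(hf'_dens ω).2]; exact one_ne_zero)
      calc ∫ x : ι → ℝ, g (q ω, x) * f (q ω) x ≤ ∫ x : ι → ℝ, f' (q ω) x / (n + 1) := by
            refine integral_mono_of_nonneg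
              (ae_of_all _ fun x => mul_nonneg (hg0 _) ((hf_dens ω).1 x))
              (hf'int.div_const _) (ae_of_all _ fun x => ?_)
            have h0 := (hf_dens ω).1 x
            have h0' := (hf'_dens ω).1 x
            simp only [hg]
            rw [div_mul_eq_mul_div]
            gcongr
            rcases h0.eq_or_lt with h | h
            · rw [← h]; simpa using h0'
            · rw [← le_div_iff₀ h]
              exact max_le (by positivity) (min_le_left _ _)
        _ = 1 / (n + 1) := by rw [integral_div, (hf'_dens ω).2]
    have hset : ∫ ω in A, g (q ω, c ω) ∂P ≤ 1 / (n + 1) * P.real A := by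
      rw [← setIntegral_condExp hm hint hA]
      calc ∫ ω in A, (P[(fun ω => g (q ω, c ω))|m]) ω ∂P
          ≤ ∫ ω in A, (1 / (n + 1) : ℝ) ∂P := by
            refine setIntegral_mono_ae integrable_condExp.integrableOn
              (integrable_const _).integrableOn ?_
            filter_upwards [hcond g hgm hgabs] with ω hω
            rw [hω]
            exact hinner ω
        _ = 1 / (n + 1) * P.real A := by
            rw [setIntegral_const, smul_eq_mul, mul_comm]
    have heq : ∀ ω, min (f' (q ω) (c ω) / f (q ω) (c ω)) (n + 1) =
        (n + 1) * g (q ω, c ω) := by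
      intro ω
      have h0 := (hf_dens ω).1 (c ω)
      have h0' := (hf'_dens ω).1 (c ω)
      simp only [hg]
      rw [mul_div_cancel₀ _ hn.ne', max_eq_right (by positivity)]
    simp_rw [heq]
    rw [← ofReal_integral_eq_lintegral_ofReal (hint.const_mul _).integrableOn
      (ae_of_all _ fun ω => mul_nonneg hn.le (hg0 _)), integral_const_mul]
    calc ENNReal.ofReal ((n + 1) * ∫ ω in A, g (q ω, c ω) ∂P)
        ≤ ENNReal.ofReal (P.real A) := by
          refine ENNReal.ofReal_le_ofReal ?_
          calc ((n : ℝ) + 1) * ∫ ω in A, g (q ω, c ω) ∂P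
              ≤ (n + 1) * (1 / (n + 1) * P.real A) := by gcongr
            _ = P.real A := by field_simp
      _ = P A := ofReal_measureReal
  have hlim : ∀ ω, ENNReal.ofReal (f' (q ω) (c ω) / f (q ω) (c ω)) =
      liminf (fun n : ℕ =>
        ENNReal.ofReal (min (f' (q ω) (c ω) / f (q ω) (c ω)) (n + 1))) atTop := by
    intro ω
    refine (Tendsto.liminf_eq (tendsto_const_nhds.congr' ?_)).symm
    obtain ⟨N, hN⟩ := exists_nat_ge (f' (q ω) (c ω) / f (q ω) (c ω))
    filter_upwards [eventually_ge_atTop N] with n hn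
    have : (N : ℝ) ≤ n := by exact_mod_cast hn
    rw [min_eq_left (by linarith)]
  simp_rw [hlim]
  refine (lintegral_liminf_le fun n => ?_).trans ?_
  · exact ((hL.comp hqc).min measurable_const).ennreal_ofReal
  · exact liminf_le_of_le (by isBoundedDefault) fun b hb => by
      obtain ⟨n, hn⟩ := hb.exists
      exact hn.trans (htrunc n)

/-- A factor whose integral over each event of a sub-σ-algebra is at most the probability of
the event does not increase the integral of weights measurable for that σ-algebra. -/
lemma lintegral_mul_le_of_setLIntegral_le {Ω : Type*} {m mΩ : MeasurableSpace Ω} (hm : m ≤ mΩ)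
    {P : Measure Ω} {W L : Ω → ENNReal} (hW : Measurable[m] W) (hL : Measurable[mΩ] L)
    (h : ∀ A, MeasurableSet[m] A → ∫⁻ ω in A, L ω ∂P ≤ P A) :
    ∫⁻ ω, W ω * L ω ∂P ≤ ∫⁻ ω, W ω ∂P := by
  have hle : (P.withDensity L).trim hm ≤ P.trim hm := by
    refine Measure.le_iff.2 fun A hA => ?_
    rw [trim_measurableSet_eq hm hA, trim_measurableSet_eq hm hA,
      withDensity_apply _ (hm A hA)]
    exact h A hA
  calc ∫⁻ ω, W ω * L ω ∂P = ∫⁻ ω, W ω ∂(P.withDensity L) := by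
        rw [lintegral_withDensity_eq_lintegral_mul _ hL (hW.mono hm le_rfl)]
        simp [mul_comm]
    _ = ∫⁻ ω, W ω ∂((P.withDensity L).trim hm) := (lintegral_trim hm hW).symm
    _ ≤ ∫⁻ ω, W ω ∂(P.trim hm) := lintegral_mono' hle le_rfl
    _ = ∫⁻ ω, W ω ∂P := lintegral_trim hm hW

/-- Ville's maximal inequality for nonnegative supermartingales. -/
lemma mul_measure_exists_lt_le {Ω : Type*} {mΩ : MeasurableSpace Ω} {P : Measure Ω}
    (F : Filtration ℕ mΩ) {R : ℕ → Ω → ENNReal} (hR : ∀ n, Measurable[F n] (R n))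
    (hsuper : ∀ n A, MeasurableSet[F n] A →
      ∫⁻ ω in A, R (n + 1) ω ∂P ≤ ∫⁻ ω in A, R n ω ∂P) (a : ENNReal) :
    a * P {ω | ∃ n, a < R n ω} ≤ ∫⁻ ω, R 0 ω ∂P := by
  set A : ℕ → Set Ω := fun n => {ω | ∀ k ≤ n, R k ω ≤ a} with hAdef
  have hAm : ∀ n, MeasurableSet[F n] (A n) := by
    intro n
    have : A n = ⋂ k, ⋂ (_ : k ≤ n), {ω | R k ω ≤ a} := by ext; simp [hAdef]
    rw [this]
    refine MeasurableSet.iInter fun k => MeasurableSet.iInter fun hk => ?_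
    exact F.mono hk _ (hR k measurableSet_Iic)
  have hAm' : ∀ n, MeasurableSet[mΩ] (A n) := fun n => F.le n _ (hAm n)
  have hsucc : ∀ n, A (n + 1) ⊆ A n := fun n ω hω k hk => hω k (hk.trans n.le_succ)
  have key : ∀ n, ∫⁻ ω in A n, R n ω ∂P + a * P (A n)ᶜ ≤ ∫⁻ ω, R 0 ω ∂P := by
    intro n
    induction n with
    | zero =>
      rw [← lintegral_add_compl (μ := P) (R 0) (hAm' 0)]
      refine add_le_add le_rfl ?_
      rw [← setLIntegral_const]
      refine setLIntegral_mono' (hAm' 0).compl fun ω hω => ?_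
      by_contra! h
      exact hω fun k hk => by rw [Nat.le_zero.1 hk]; exact h.le
    | succ n ih =>
      refine le_trans ?_ ih
      have hdiff : a * P (A n \ A (n + 1)) ≤ ∫⁻ ω in A n \ A (n + 1), R (n + 1) ω ∂P := by
        rw [← setLIntegral_const]
        refine setLIntegral_mono' ((hAm' n).diff (hAm' (n + 1))) fun ω hω => ?_
        by_contra! h
        refine hω.2 fun k hk => ?_
        rcases Nat.le_succ_iff.1 hk with hk | rfl
        · exact hω.1 k hk
        · exact h.le
      have hcompl : P (A (n + 1))ᶜ ≤ P (A n \ A (n + 1)) + P (A n)ᶜ := by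
        refine (measure_mono fun ω hω => ?_).trans (measure_union_le _ _)
        by_cases h : ω ∈ A n
        · exact Or.inl ⟨h, hω⟩
        · exact Or.inr h
      calc ∫⁻ ω in A (n + 1), R (n + 1) ω ∂P + a * P (A (n + 1))ᶜ
          ≤ ∫⁻ ω in A (n + 1), R (n + 1) ω ∂P +
              (∫⁻ ω in A n \ A (n + 1), R (n + 1) ω ∂P + a * P (A n)ᶜ) := by
            gcongr
            refine (mul_le_mul_right hcompl a).trans ?_
            rw [mul_add]
            gcongr
        _ = ∫⁻ ω in A n, R (n + 1) ω ∂P + a * P (A n)ᶜ := by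
            rw [← add_assoc]
            congr 1
            conv_rhs => rw [← lintegral_inter_add_sdiff (R (n + 1)) (A n) (hAm' (n + 1)),
              Set.inter_eq_self_of_subset_right (hsucc n)]
        _ ≤ ∫⁻ ω in A n, R n ω ∂P + a * P (A n)ᶜ := by
            gcongr 1
            exact hsuper n _ (hAm n)
  have hunion : {ω | ∃ n, a < R n ω} = ⋃ n, (A n)ᶜ := by
    ext ω
    simp only [hAdef, Set.mem_ofPred_eq, Set.mem_iUnion, Set.mem_compl_iff, not_forall, not_le]
    exact ⟨fun ⟨n, hn⟩ => ⟨n, n, le_rfl, hn⟩, fun ⟨_, k, _, hk⟩ => ⟨k, hk⟩⟩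
  have hmono : Monotone fun n => (A n)ᶜ :=
    monotone_nat_of_le_succ fun n => Set.compl_subset_compl.2 (hsucc n)
  rw [hunion, hmono.measure_iUnion, ENNReal.mul_iSup]
  exact iSup_le fun n => le_add_self.trans (key n)

section BayesProcess

variable {ι S E Ω : Type} [Fintype ι] [Fintype S]
  [NormedAddCommGroup E] [NormedSpace ℝ E] [MeasurableSpace E] [mΩ : MeasurableSpace Ω]
  {P : Measure Ω} [IsProbabilityMeasure P] {F : Filtration ℕ mΩ}
  {strue : S} {Q : Set E} {φ : S → E → (ι → ℝ) → ℝ} {θ0 : S → ℝ}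
  {θ : ℕ → Ω → S → ℝ} {q : ℕ → Ω → E} {c : ℕ → Ω → ι → ℝ}

omit [IsProbabilityMeasure P] in
lemma belief_nonneg (henv : IsBayesEnv strue Q φ)
    (hproc : IsBayesProcess P F strue Q φ θ0 θ q c) (t : ℕ) (ω : Ω) (s : S) :
    0 ≤ θ t ω s := by
  obtain ⟨-, -, -, -, hφ⟩ := henv
  obtain ⟨hpos, -, hinit, hqQ, -, -, -, -, hstep⟩ := hproc
  induction t generalizing s with
  | zero => rw [hinit]; exact (hpos s).le
  | succ t ih =>
    rw [hstep]
    have h : ∀ s', 0 ≤ θ t ω s' * φ s' (q t ω) (c t ω) := fun s' =>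
      mul_nonneg (ih s') ((hφ s' _ (hqQ t ω)).1 _)
    exact div_nonneg (h s) (Finset.sum_nonneg fun s' _ => h s')

omit [IsProbabilityMeasure P] in
lemma belief_le_one (henv : IsBayesEnv strue Q φ)
    (hproc : IsBayesProcess P F strue Q φ θ0 θ q c) (t : ℕ) (ω : Ω) (s : S) :
    θ t ω s ≤ 1 := by
  have hnn := belief_nonneg henv hproc
  obtain ⟨-, -, -, -, hφ⟩ := henv
  obtain ⟨hpos, hsum, hinit, hqQ, -, -, -, -, hstep⟩ := hproc
  cases t with
  | zero =>
    rw [hinit, ← hsum]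
    exact Finset.single_le_sum (fun s' _ => (hpos s').le) (Finset.mem_univ s)
  | succ t =>
    rw [hstep]
    have h : ∀ s', 0 ≤ θ t ω s' * φ s' (q t ω) (c t ω) := fun s' =>
      mul_nonneg (hnn t ω s') ((hφ s' _ (hqQ t ω)).1 _)
    exact div_le_one_of_le₀ (Finset.single_le_sum (fun s' _ => h s') (Finset.mem_univ s))
      (Finset.sum_nonneg fun s' _ => h s')

lemma ae_density_true_pos (henv : IsBayesEnv strue Q φ)
    (hproc : IsBayesProcess P F strue Q φ θ0 θ q c) (t : ℕ) :
    ∀ᵐ ω ∂P, 0 < φ strue (q t ω) (c t ω) := by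
  obtain ⟨-, -, hφm, -, hφ⟩ := henv
  obtain ⟨-, -, -, hqQ, hq, hc, -, hcond, -⟩ := hproc
  have hqc : Measurable[mΩ] fun ω => (q t ω, c t ω) :=
    ((hq t).mono (F.le t) le_rfl).prodMk ((hc t).mono (F.le (t + 1)) le_rfl)
  set B : Set (E × (ι → ℝ)) := {p | φ strue p.1 p.2 ≤ 0} with hB
  have hBm : MeasurableSet B := hφm strue measurableSet_Iic
  have hce := hcond t (B.indicator fun _ => 1) (measurable_const.indicator hBm) fun p => by
    by_cases h : p ∈ B <;> simp [h]
  have hzero : ∀ ω, ∫ x : ι → ℝ, B.indicator (fun _ => (1 : ℝ)) (q t ω, x) *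
      φ strue (q t ω) x = 0 := by
    intro ω
    refine integral_eq_zero_of_ae (ae_of_all _ fun x => ?_)
    by_cases h : (q t ω, x) ∈ B
    · have : φ strue (q t ω) x = 0 := le_antisymm h ((hφ strue _ (hqQ t ω)).1 x)
      simp [this]
    · simp [h]
  have hmeas : MeasurableSet[mΩ] ((fun ω => (q t ω, c t ω)) ⁻¹' B) := hqc hBm
  have hint : ∫ ω, B.indicator (fun _ => (1 : ℝ)) (q t ω, c t ω) ∂P = 0 := by
    rw [← integral_condExp (F.le t), integral_congr_ae hce]
    simp [hzero]
  have heq : (fun ω => B.indicator (fun _ => (1 : ℝ)) (q t ω, c t ω)) =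
      ((fun ω => (q t ω, c t ω)) ⁻¹' B).indicator 1 := by
    ext ω
    simp [Set.indicator]
  rw [heq, integral_indicator_one hmeas, measureReal_eq_zero_iff] at hint
  refine measure_mono_null (fun ω hω => ?_) hint
  simpa [hB] using hω

lemma ae_belief_true_pos (henv : IsBayesEnv strue Q φ)
    (hproc : IsBayesProcess P F strue Q φ θ0 θ q c) :
    ∀ᵐ ω ∂P, ∀ t, 0 < θ t ω strue := by
  have hnn := belief_nonneg henv hproc
  filter_upwards [ae_all_iff.2 (ae_density_true_pos henv hproc)] with ω hω t
  obtain ⟨-, -, -, -, hφ⟩ := henv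
  obtain ⟨hpos, -, hinit, hqQ, -, -, -, -, hstep⟩ := hproc
  induction t with
  | zero => rw [hinit]; exact hpos strue
  | succ t ih =>
    rw [hstep]
    have h := mul_pos ih (hω t)
    exact div_pos h (h.trans_le (Finset.single_le_sum
      (f := fun s' => θ t ω s' * φ s' (q t ω) (c t ω))
      (fun s' _ => mul_nonneg (hnn t ω s') ((hφ s' _ (hqQ t ω)).1 _)) (Finset.mem_univ strue)))

/-- The posterior odds of any parameter against the true one form a supermartingale. -/
lemma setLIntegral_odds_succ_le (henv : IsBayesEnv strue Q φ)
    (hproc : IsBayesProcess P F strue Q φ θ0 θ q c) (s : S) (t : ℕ) {A : Set Ω}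
    (hA : MeasurableSet[F t] A) :
    ∫⁻ ω in A, ENNReal.ofReal (θ (t + 1) ω s / θ (t + 1) ω strue) ∂P ≤
      ∫⁻ ω in A, ENNReal.ofReal (θ t ω s / θ t ω strue) ∂P := by
  have hnn := belief_nonneg henv hproc
  obtain ⟨-, -, hφm, -, hφ⟩ := henv
  obtain ⟨-, -, -, hqQ, hq, hc, hθ, hcond, hstep⟩ := hproc
  have hq' := (hq t).mono (F.le t) le_rfl
  have hc' := (hc t).mono (F.le (t + 1)) le_rfl
  have hθs : ∀ s', Measurable[F t] fun ω => θ t ω s' := fun s' =>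
    (measurable_pi_apply s').comp (hθ t)
  have hratio : ∀ ω, ENNReal.ofReal (θ (t + 1) ω s / θ (t + 1) ω strue) ≤
      ENNReal.ofReal (θ t ω s / θ t ω strue) *
        ENNReal.ofReal (φ s (q t ω) (c t ω) / φ strue (q t ω) (c t ω)) := by
    intro ω
    have hodds : 0 ≤ θ t ω s / θ t ω strue := div_nonneg (hnn t ω s) (hnn t ω strue)
    rw [← ENNReal.ofReal_mul hodds]
    refine ENNReal.ofReal_le_ofReal ?_
    rw [hstep, hstep]
    by_cases hZ : ∑ s', θ t ω s' * φ s' (q t ω) (c t ω) = 0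
    · rw [hZ, div_zero, div_zero, div_zero]
      exact mul_nonneg hodds
        (div_nonneg ((hφ s _ (hqQ t ω)).1 _) ((hφ strue _ (hqQ t ω)).1 _))
    · rw [div_div_div_cancel_right₀ hZ, mul_div_mul_comm]
  refine (lintegral_mono hratio).trans ?_
  have hW : Measurable[F t] (A.indicator fun ω => ENNReal.ofReal (θ t ω s / θ t ω strue)) :=
    Measurable.indicator (((hθs s).div (hθs strue)).ennreal_ofReal) hA
  have hL : Measurable[mΩ] fun ω =>
      ENNReal.ofReal (φ s (q t ω) (c t ω) / φ strue (q t ω) (c t ω)) :=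
    (((hφm s).div (hφm strue)).comp (hq'.prodMk hc')).ennreal_ofReal
  have key := lintegral_mul_le_of_setLIntegral_le (F.le t) (P := P) hW hL fun B hB =>
    setLIntegral_likelihoodRatio_le (F.le t) (hφm strue) (hφm s) hq' hc'
      (fun ω => hφ strue _ (hqQ t ω)) (fun ω => hφ s _ (hqQ t ω)) (hcond t) hB
  rw [lintegral_indicator (F.le t _ hA)] at key
  refine le_trans (le_of_eq ?_) key
  rw [← lintegral_indicator (F.le t _ hA)]
  congr 1 with ω
  by_cases h : ω ∈ A <;> simp [h]

lemma measure_exists_belief_gt_le (henv : IsBayesEnv strue Q φ)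
    (hproc : IsBayesProcess P F strue Q φ θ0 θ q c) (s : S) {κ : ℝ} (hκ : 0 < κ) :
    P {ω | ∃ t, κ < θ t ω s} ≤ ENNReal.ofReal (θ0 s / θ0 strue / κ) := by
  have hθs : ∀ t s', Measurable[F t] fun ω => θ t ω s' := fun t s' =>
    (measurable_pi_apply s').comp (hproc.2.2.2.2.2.2.1 t)
  have hville := mul_measure_exists_lt_le (P := P) F
    (R := fun t ω => ENNReal.ofReal (θ t ω s / θ t ω strue))
    (fun t => ((hθs t s).div (hθs t strue)).ennreal_ofReal)
    (fun t A hA => setLIntegral_odds_succ_le henv hproc s t hA) (ENNReal.ofReal κ)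
  simp only [hproc.2.2.1, lintegral_const, measure_univ, mul_one] at hville
  rw [ENNReal.ofReal_div_of_pos hκ,
    ENNReal.le_div_iff_mul_le (Or.inl (by simpa using hκ)) (Or.inl ENNReal.ofReal_ne_top),
    mul_comm]
  refine le_trans (mul_le_mul_right (measure_mono_ae ?_) _) hville
  filter_upwards [ae_belief_true_pos henv hproc] with ω hω
  rintro ⟨t, ht⟩
  have hle : θ t ω s ≤ θ t ω s / θ t ω strue :=
    le_div_self (belief_nonneg henv hproc t ω s) (hω t) (belief_le_one henv hproc t ω strue)
  exact ⟨t, (ENNReal.ofReal_lt_ofReal_iff (hκ.trans (ht.trans_le hle))).2 (ht.trans_le hle)⟩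

end BayesProcess

/-- **Uniform control of the beliefs of parameters outside the support of `θ̄`.**
Fix `θ̄ ∈ Δ(S)` with `θ̄(s*) > 0`.  For every `γ, κ ∈ (0,1)` there is `ρ > 0` such that,
for any run of the Bayesian learning dynamics whose initial belief satisfies
`θ¹(s) < ρ` for every `s ∉ [θ̄]` and `θ¹(s*) > θ̄(s*) − ρ`, with probability greater
than `γ` the beliefs of all parameters outside `[θ̄]` stay below `κ` forever. -/
theorem nonsupport_beliefs_stay_small {ι S E Ω : Type} [Fintype ι] [Fintype S]
    [NormedAddCommGroup E] [NormedSpace ℝ E] [MeasurableSpace E] [BorelSpace E]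
    [mΩ : MeasurableSpace Ω]
    (P : Measure Ω) [IsProbabilityMeasure P] (F : Filtration ℕ mΩ)
    (strue : S) (Q : Set E) (φ : S → E → (ι → ℝ) → ℝ)
    (henv : IsBayesEnv strue Q φ)
    (θbar : S → ℝ) (hθbar_nn : ∀ s, 0 ≤ θbar s) (hθbar_sum : ∑ s, θbar s = 1)
    (hθbar_pos : 0 < θbar strue)
    (γ κ : ℝ) (hγ : γ ∈ Set.Ioo (0 : ℝ) 1) (hκ : κ ∈ Set.Ioo (0 : ℝ) 1) :
    ∃ ρ > 0, ∀ (θ0 : S → ℝ) (θ : ℕ → Ω → S → ℝ) (q : ℕ → Ω → E) (c : ℕ → Ω → ι → ℝ),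
      IsBayesProcess P F strue Q φ θ0 θ q c →
      (∀ s, θbar s = 0 → θ0 s < ρ) →
      θbar strue - ρ < θ0 strue →
      γ < (P {ω | ∀ t : ℕ, ∀ s, θbar s = 0 → θ t ω s ≤ κ}).toReal := by
  classical
  obtain ⟨hγ0, hγ1⟩ := hγ
  obtain ⟨hκ0, -⟩ := hκ
  set N : ℝ := (Fintype.card S : ℝ) with hN
  have hN0 : 0 ≤ N := Nat.cast_nonneg _
  set d : ℝ := θbar strue / 2 with hd
  have hd0 : 0 < d := by positivity
  have hγ' : 0 < 1 - γ := by linarith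
  set ε : ℝ := (1 - γ) / (N + 1) with hε
  have hε0 : 0 < ε := by positivity
  refine ⟨min d (d * κ * ε), by positivity, fun θ0 θ q c hproc hsmall htrue => ?_⟩
  have hd_lt : d < θ0 strue := by
    have := min_le_left d (d * κ * ε)
    linarith
  set G := {ω | ∀ t : ℕ, ∀ s, θbar s = 0 → θ t ω s ≤ κ} with hG
  have hbad : P Gᶜ ≤ ENNReal.ofReal (N * ε) := by
    have hsub : Gᶜ ⊆ ⋃ s ∈ Finset.univ.filter (fun s => θbar s = 0),
        {ω | ∃ t, κ < θ t ω s} := by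
      intro ω hω
      simp only [hG, Set.mem_compl_iff, Set.mem_ofPred_eq, not_forall, not_le] at hω
      obtain ⟨t, s, hs, h⟩ := hω
      simp only [Set.mem_iUnion]
      exact ⟨s, by simpa using hs, t, h⟩
    calc P Gᶜ ≤ ∑ s ∈ Finset.univ.filter (fun s => θbar s = 0), P {ω | ∃ t, κ < θ t ω s} :=
          (measure_mono hsub).trans (measure_biUnion_finset_le _ _)
      _ ≤ ∑ s ∈ Finset.univ.filter (fun s => θbar s = 0), ENNReal.ofReal ε := by
          refine Finset.sum_le_sum fun s hs => ?_
          refine (measure_exists_belief_gt_le henv hproc s hκ0).trans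
            (ENNReal.ofReal_le_ofReal ?_)
          have hs' : θ0 s < d * κ * ε :=
            (hsmall s (by simpa using hs)).trans_le (min_le_right _ _)
          rw [div_div, div_le_iff₀ (mul_pos (hd0.trans hd_lt) hκ0)]
          calc θ0 s ≤ ε * (d * κ) := by linarith
            _ ≤ ε * (θ0 strue * κ) := by gcongr
      _ ≤ ∑ _s : S, ENNReal.ofReal ε :=
          Finset.sum_le_sum_of_subset (Finset.filter_subset _ _)
      _ = ENNReal.ofReal (N * ε) := by
          rw [Finset.sum_const, nsmul_eq_mul, ENNReal.ofReal_mul hN0, hN,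
            ENNReal.ofReal_natCast, Finset.card_univ]
  have hbad' : P.real Gᶜ ≤ N * ε := ENNReal.toReal_le_of_le_ofReal (by positivity) hbad
  have hone : 1 ≤ P.real G + P.real Gᶜ := by
    have := measureReal_union_le (μ := P) G Gᶜ
    simpa using this
  have hlt : N * ε < 1 - γ := by
    have h : N * ε + ε = 1 - γ := by rw [hε]; field_simp
    linarith
  change γ < P.real G
  linarith
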